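/- Let X be a finite-dimensional real vector space with inner product ⟨·,·⟩ and norm N, and let T : X → X be continuous with lim_{N(w)→∞} ⟨T(w), w⟩ / N(w) = +∞. Then T is onto: for every L ∈ X there exists u ∈ X with T(u) = L. -/

import Mathlib

open RealInnerProductSpace

/-- `det (1 + t A)` is a polynomial in `t` of degree at most the dimension. -/
lemma aux_det_poly {X : Type*} [NormedAddCommGroup X] [NormedSpace ℝ X]
    [FiniteDimensional ℝ X] (A : X →L[ℝ] X) :
    ∃ p : Polynomial ℝ, p.natDegree ≤ Module.finrank ℝ X ∧
      ∀ t : ℝ, (ContinuousLinearMap.id ℝ X + t • A).det = p.eval t := by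
  let b := Module.finBasis ℝ X
  let M := LinearMap.toMatrix b b (A : X →ₗ[ℝ] X)
  refine ⟨_, (Polynomial.natDegree_det_X_add_C_le M 1).trans (by simp), fun t => ?_⟩
  have h1 : (ContinuousLinearMap.id ℝ X + t • A).det
      = LinearMap.det (LinearMap.id + t • (A : X →ₗ[ℝ] X)) := rfl
  rw [h1, ← LinearMap.det_toMatrix b, map_add, map_smul, LinearMap.toMatrix_id,
    ← Polynomial.coe_evalRingHom, RingHom.map_det]
  congr 1
  ext i j
  simp [M, Matrix.one_apply, apply_ite, add_comm]
  exact mul_comm _ _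

lemma aux_det_pos {X : Type*} [NormedAddCommGroup X] [NormedSpace ℝ X]
    [FiniteDimensional ℝ X] (A : X →L[ℝ] X) (K t : ℝ) (hA : ‖A‖ ≤ K) (ht : 0 ≤ t)
    (htK : t * K < 1) : 0 < (ContinuousLinearMap.id ℝ X + t • A).det := by
  have hne : ∀ s ∈ Set.Icc 0 t, (ContinuousLinearMap.id ℝ X + s • A).det ≠ 0 := by
    intro s hs h0
    have h1 : LinearMap.det ((ContinuousLinearMap.id ℝ X + s • A : X →L[ℝ] X) : X →ₗ[ℝ] X) = 0 := h0
    obtain ⟨v, hv, hv0⟩ := Submodule.exists_mem_ne_zero_of_ne_bot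
      (LinearMap.bot_lt_ker_of_det_eq_zero h1).ne'
    have hv' : v + s • A v = 0 := by simpa using hv
    have h2 : ‖v‖ = s * ‖A v‖ := by
      rw [eq_neg_of_add_eq_zero_left hv', norm_neg, norm_smul, Real.norm_of_nonneg hs.1]
      rw [← eq_neg_of_add_eq_zero_left hv']
    have h3 : ‖A v‖ ≤ K * ‖v‖ := A.le_of_opNorm_le hA v
    have h4 : 0 < ‖v‖ := norm_pos_iff.2 hv0
    have hK : 0 ≤ K := (norm_nonneg _).trans hA
    have : s * ‖A v‖ ≤ t * (K * ‖v‖) := by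
      apply mul_le_mul hs.2 h3 (norm_nonneg _) ht
    nlinarith
  obtain ⟨p, -, hp⟩ := aux_det_poly A
  by_contra hcon
  push Not at hcon
  have hc : ContinuousOn (fun s : ℝ => (ContinuousLinearMap.id ℝ X + s • A).det) (Set.Icc 0 t) := by
    simp only [hp]; fun_prop
  have h00 : (ContinuousLinearMap.id ℝ X + (0 : ℝ) • A).det = 1 := by
    simp [ContinuousLinearMap.det]
  have := intermediate_value_Icc' ht hc
  obtain ⟨s, hs, hs0⟩ := this ⟨hcon, by simp only [h00]; norm_num⟩
  exact hne s hs hs0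

/-- A function that is Lipschitz on a closed ball, vanishing on the sphere, extends by zero. -/
lemma aux_lip {X : Type*} [NormedAddCommGroup X] [NormedSpace ℝ X]
    (h : X → X) (R : ℝ) (K : NNReal)
    (hK : LipschitzOnWith K h (Metric.closedBall 0 R)) (hs : ∀ x, ‖x‖ = R → h x = 0) :
    LipschitzWith K ((Metric.closedBall (0 : X) R).indicator h) := by
  have key : ∀ x y : X, ‖x‖ ≤ R → R < ‖y‖ → ‖h x‖ ≤ K * dist x y := by
    intro x y hx hy
    have hc : ContinuousOn (fun s : ℝ => ‖x + s • (y - x)‖) (Set.Icc 0 1) := by fun_prop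
    obtain ⟨s, hs1, hs2⟩ := intermediate_value_Icc zero_le_one hc
      (show R ∈ _ from ⟨by simpa using hx, by simpa using hy.le⟩)
    have h1 := hK.dist_le_mul x (by simpa using hx) (x + s • (y - x)) (by simpa using hs2.le)
    rw [hs _ hs2, dist_zero_right] at h1
    refine h1.trans (mul_le_mul_of_nonneg_left ?_ K.2)
    rw [dist_self_add_right, norm_smul, dist_comm, dist_eq_norm, Real.norm_of_nonneg hs1.1]
    exact mul_le_of_le_one_left (norm_nonneg _) hs1.2
  refine LipschitzWith.of_dist_le_mul fun x y => ?_
  by_cases hx : ‖x‖ ≤ R <;> by_cases hy : ‖y‖ ≤ R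
  · rw [Set.indicator_of_mem (by simpa using hx), Set.indicator_of_mem (by simpa using hy)]
    exact hK.dist_le_mul x (by simpa using hx) y (by simpa using hy)
  · rw [Set.indicator_of_mem (by simpa using hx), Set.indicator_of_notMem (by simpa using hy),
      dist_zero_right]
    exact key x y hx (not_le.1 hy)
  · rw [Set.indicator_of_notMem (a := x) (by simpa using hx),
      Set.indicator_of_mem (a := y) (by simpa using hy), dist_zero_left, dist_comm]
    exact key y x hy (not_le.1 hx)
  · rw [Set.indicator_of_notMem (by simpa using hx), Set.indicator_of_notMem (by simpa using hy)]
    simp only [dist_self]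
    positivity

lemma aux_bij {X : Type*} [NormedAddCommGroup X] [NormedSpace ℝ X] [CompleteSpace X]
    (g : X → X) (K : NNReal) (hg : LipschitzWith K g) (t : ℝ) (ht : 0 ≤ t) (htK : t * K < 1) :
    Function.Bijective (fun x => x + t • g x) := by
  have hcontr : ∀ y, ContractingWith (t.toNNReal * K) (fun x => y - t • g x) := by
    intro y
    refine ⟨by rw [← NNReal.coe_lt_coe]; simpa [ht] using htK, LipschitzWith.of_dist_le_mul fun a b => ?_⟩
    rw [dist_sub_left, dist_smul₀, Real.norm_of_nonneg ht]
    have := mul_le_mul_of_nonneg_left (hg.dist_le_mul a b) ht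
    simpa [mul_assoc, ht] using this
  constructor
  · intro a b hab
    have hab' : a + t • g a = b + t • g b := hab
    refine (hcontr (a + t • g a)).fixedPoint_unique' (x := a) (y := b) ?_ ?_
    · simp [Function.IsFixedPt]
    · simp [Function.IsFixedPt, hab']
  · intro y
    have := (hcontr y).fixedPoint_isFixedPt
    exact ⟨ContractingWith.fixedPoint _ (hcontr y), (sub_eq_iff_eq_add.1 this).symm⟩

open MeasureTheory in
/-- There is no `C¹` retraction of the ball onto the sphere. -/
lemma aux_no_retract {X : Type*} [NormedAddCommGroup X] [InnerProductSpace ℝ X]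
    [FiniteDimensional ℝ X] [MeasurableSpace X] [BorelSpace X]
    (f : X → X) (hf : ContDiff ℝ 1 f) (R : ℝ) (hR : 0 < R)
    (hn : ∀ x, ‖f x‖ = R) (hs : ∀ x, ‖x‖ = R → f x = x) : False := by
  let h : X → X := fun x => f x - x
  have hh : ContDiff ℝ 1 h := hf.sub contDiff_id
  obtain ⟨K, hK⟩ := (hh.contDiffOn (s := Metric.closedBall 0 R)).exists_lipschitzOnWith
    one_ne_zero (convex_closedBall 0 R) (isCompact_closedBall 0 R)
  have hg := aux_lip h R K hK (fun x hx => by simp [h, hs x hx])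
  set g := (Metric.closedBall (0 : X) R).indicator h with hgdef
  let B := Metric.ball (0 : X) R
  let V : ℝ := (volume : Measure X).real B
  have hV : 0 < V := ENNReal.toReal_pos (Metric.measure_ball_pos _ _ hR).ne' measure_ball_lt_top.ne
  let J : ℝ → X → ℝ := fun t x => (ContinuousLinearMap.id ℝ X + t • fderiv ℝ h x).det
  have hsmall : ∀ t : ℝ, 0 ≤ t → t * K < 1 → IntegrableOn (J t) B ∧ ∫ x in B, J t x = V := by
    intro t ht htK
    have hbij := aux_bij g K hg t ht htK
    set F : X → X := fun x => x + t • g x with hF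
    have himc : F '' Bᶜ = Bᶜ := by
      have : ∀ x ∈ Bᶜ, F x = x := by
        intro x hx
        have hx' : R ≤ ‖x‖ := by simpa [B] using hx
        have : g x = 0 := by
          rcases hx'.eq_or_lt with h1 | h1
          · rw [hgdef, Set.indicator_of_mem (by simpa using h1.ge)]
            simp [h, hs x h1.symm]
          · rw [hgdef, Set.indicator_of_notMem (by simpa using h1)]
        simp [hF, this]
      rw [Set.image_congr this, Set.image_id']
    have him : F '' B = B := by
      rw [Set.image_compl_eq hbij] at himc
      exact compl_injective himc
    have hder : ∀ x ∈ B, HasFDerivWithinAt F (ContinuousLinearMap.id ℝ X + t • fderiv ℝ h x) B x := by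
      intro x hx
      have h1 : HasFDerivAt (fun x => x + t • h x)
          (ContinuousLinearMap.id ℝ X + t • fderiv ℝ h x) x :=
        (hasFDerivAt_id x).add
          (((hh.differentiable one_ne_zero) x).hasFDerivAt.const_smul t)
      refine HasFDerivWithinAt.congr' h1.hasFDerivWithinAt (fun y hy => ?_) hx
      simp only [hF, hgdef]
      rw [Set.indicator_of_mem (Metric.ball_subset_closedBall hy)]
    have hpos : ∀ x ∈ B, |J t x| = J t x := by
      intro x hx
      refine abs_of_pos (aux_det_pos _ K t ?_ ht htK)
      exact norm_fderiv_le_of_lipschitzOn ℝ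
        (Filter.mem_of_superset (Metric.isOpen_ball.mem_nhds hx) Metric.ball_subset_closedBall) hK
    have hmB : MeasurableSet B := Metric.isOpen_ball.measurableSet
    constructor
    · have := (integrableOn_image_iff_integrableOn_abs_det_fderiv_smul volume hmB hder
        hbij.1.injOn (fun _ => (1 : ℝ))).1 (by
          rw [him]; exact integrableOn_const measure_ball_lt_top.ne)
      refine this.congr_fun (fun x hx => ?_) hmB
      simpa [J] using hpos x hx
    · have := integral_image_eq_integral_abs_det_fderiv_smul volume hmB hder
        hbij.1.injOn (fun _ => (1 : ℝ))
      rw [him] at this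
      rw [setIntegral_congr_fun hmB (g := fun x => |J t x|) (fun x hx => (hpos x hx).symm)]
      simpa [J, V] using this.symm
  let n := Module.finrank ℝ X
  let s := Finset.range (n + 1)
  let v : ℕ → ℝ := fun i => 1 / ((K + 1) * (i + 1))
  have hK0 : (0 : ℝ) ≤ K := K.2
  have hv0 : ∀ i, 0 ≤ v i := fun i => by positivity
  have hvK : ∀ i, v i * K < 1 := by
    intro i
    have hi : (0 : ℝ) ≤ i := i.cast_nonneg
    simp only [v]
    rw [div_mul_eq_mul_div, div_lt_one (by positivity)]
    nlinarith
  have hvinj : Set.InjOn v s := by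
    intro i _ j _ hij
    simp only [v] at hij
    rw [one_div, one_div, inv_inj] at hij
    have := mul_left_cancel₀ (by positivity) hij
    exact_mod_cast add_right_cancel this
  let c : ℕ → ℝ := fun i => (Lagrange.basis s v i).eval 1
  have hcsum : ∑ i ∈ s, c i = 1 := by
    have := congrArg (Polynomial.eval 1) (Lagrange.sum_basis hvinj ⟨0, by simp [s]⟩)
    simpa [Polynomial.eval_finsetSum] using this
  have hJ1 : ∀ x, J 1 x = ∑ i ∈ s, c i * J (v i) x := by
    intro x
    obtain ⟨p, hpd, hp⟩ := aux_det_poly (fderiv ℝ h x)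
    simp only [J, hp]
    have hdeg : p.degree < s.card := by
      refine Polynomial.degree_le_natDegree.trans_lt ?_
      simp only [s, Finset.card_range]
      exact_mod_cast Nat.lt_succ_of_le hpd
    have := congrArg (Polynomial.eval 1) (Lagrange.eq_interpolate hvinj hdeg)
    rw [this, Lagrange.interpolate_apply, Polynomial.eval_finsetSum]
    refine Finset.sum_congr rfl fun i _ => ?_
    simp [c, mul_comm]
  have hint1 : ∫ x in B, J 1 x = V := by
    simp only [hJ1]
    rw [integral_finsetSum _ (fun i _ => ((hsmall _ (hv0 i) (hvK i)).1.const_mul _))]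
    simp only [integral_const_mul, (hsmall _ (hv0 _) (hvK _)).2]
    rw [← Finset.sum_mul, hcsum, one_mul]
  have hJ0 : ∀ x, J 1 x = 0 := by
    intro x
    by_contra hne
    have hfd : DifferentiableAt ℝ f x := (hf.differentiable one_ne_zero) x
    have hfx : ContinuousLinearMap.id ℝ X + (1 : ℝ) • fderiv ℝ h x = fderiv ℝ f x := by
      have : fderiv ℝ h x = fderiv ℝ f x - ContinuousLinearMap.id ℝ X :=
        (hfd.hasFDerivAt.sub (hasFDerivAt_id x)).fderiv
      rw [this]; simp
    have hne' : LinearMap.det (fderiv ℝ f x : X →ₗ[ℝ] X) ≠ 0 := by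
      simp only [J] at hne
      rw [hfx] at hne
      exact hne
    obtain ⟨w, hw⟩ : ∃ w, fderiv ℝ f x w = f x := by
      have := (LinearMap.equivOfDetNeZero _ hne').surjective (f x)
      exact this
    have h1 : HasFDerivAt (fun y => ⟪f y, f y⟫) _ x := hfd.hasFDerivAt.inner ℝ hfd.hasFDerivAt
    have h2 : (fun y => ⟪f y, f y⟫) = fun _ => R ^ 2 := by
      ext y; rw [real_inner_self_eq_norm_sq, hn]
    rw [h2] at h1
    have h3 := congrArg (fun L : X →L[ℝ] ℝ => L w) (h1.unique (hasFDerivAt_const _ _))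
    simp [hw, hn, hR.ne'] at h3
  simp [hJ0] at hint1
  exact hV.ne hint1

lemma aux_zero {X : Type*} [NormedAddCommGroup X] [InnerProductSpace ℝ X]
    [FiniteDimensional ℝ X] (T : X → X) (hT : Continuous T) (R : ℝ) (hR : 0 < R)
    (hpos : ∀ x, R ≤ ‖x‖ → 0 < ⟪T x, x⟫) : ∃ x, T x = 0 := by
  by_contra! hne
  let t : X → Set X := fun x => {y | 0 < ⟪y, T x⟫ ∧ (R ≤ ‖x‖ → 0 < ⟪y, x⟫)}
  have hconv : ∀ x, Convex ℝ (t x) := by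
    intro x y hy z hz a b ha hb hab
    have key : ∀ p q : ℝ, 0 < p → 0 < q → 0 < a * p + b * q := by
      intro p q hp hq
      rcases ha.eq_or_lt with h | h
      · have : b = 1 := by linarith
        subst this; rw [← h]; simpa
      · positivity
    simp only [t, Set.mem_ofPred_eq, inner_add_left, real_inner_smul_left]
    exact ⟨key _ _ hy.1 hz.1, fun h => key _ _ (hy.2 h) (hz.2 h)⟩
  have hloc : ∀ x : X, ∃ c : X, ∀ᶠ y in nhds x, c ∈ t y := by
    intro x
    refine ⟨T x, ?_⟩
    have h1 : ∀ᶠ y in nhds x, 0 < ⟪T x, T y⟫ := by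
      refine (show Continuous fun y => ⟪T x, T y⟫ by fun_prop).continuousAt.eventually_const_lt ?_
      exact real_inner_self_pos.2 (hne x)
    have h2 : ∀ᶠ y in nhds x, R ≤ ‖y‖ → 0 < ⟪T x, y⟫ := by
      rcases lt_or_ge ‖x‖ R with h | h
      · filter_upwards [continuous_norm.continuousAt.eventually_lt_const h] with y hy hy'
        exact absurd hy' (not_le.2 hy)
      · filter_upwards [(show Continuous fun y => ⟪T x, y⟫ by
          fun_prop).continuousAt.eventually_const_lt (hpos x h)] with y hy _ using hy
    exact h1.and h2
  obtain ⟨P, hP⟩ := exists_contMDiffMap_forall_mem_convex_of_local_const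
    (n := 1) (modelWithCornersSelf ℝ X) hconv hloc
  have hPs : ContDiff ℝ 1 P := P.contMDiff.contDiff
  let φ : ContDiffBump (0 : X) := ⟨R, R + 1, hR, by linarith⟩
  let G : X → X := fun x => φ x • P x + (1 - φ x) • x
  have hG : ContDiff ℝ 1 G :=
    (φ.contDiff.smul hPs).add ((contDiff_const.sub φ.contDiff).smul contDiff_id)
  have hG0 : ∀ x, G x ≠ 0 := by
    intro x h0
    rcases le_or_gt R ‖x‖ with h | h
    · have h1 : ⟪G x, x⟫ = φ x * ⟪P x, x⟫ + (1 - φ x) * ‖x‖ ^ 2 := by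
        simp only [G, inner_add_left, real_inner_smul_left, real_inner_self_eq_norm_sq]
      rw [h0, inner_zero_left] at h1
      have h2 := (hP x).2 h
      have h3 : 0 < ‖x‖ ^ 2 := by have : 0 < ‖x‖ := hR.trans_le h
                                  positivity
      have h4 := φ.nonneg' x
      have h5 : φ x ≤ 1 := φ.le_one
      rcases h4.eq_or_lt with h6 | h6
      · rw [← h6] at h1; linarith
      · nlinarith [mul_pos h6 h2]
    · have h1 : φ x = 1 := φ.one_of_mem_closedBall (by simpa [φ] using h.le)
      have h2 : P x = 0 := by simpa [G, h1] using h0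
      have := (hP x).1
      rw [h2, inner_zero_left] at this
      exact lt_irrefl _ this
  let _ : MeasurableSpace X := borel X
  have : BorelSpace X := ⟨rfl⟩
  refine aux_no_retract (fun x => ((R + 1) / ‖G x‖) • G x) ?_ (R + 1) (by linarith) ?_ ?_
  · exact (contDiff_const.div (hG.norm ℝ hG0) (fun x => norm_ne_zero_iff.2 (hG0 x))).smul hG
  · intro x
    have := norm_pos_iff.2 (hG0 x)
    rw [norm_smul, Real.norm_of_nonneg (by positivity)]
    field_simp
  · intro x hx
    have h1 : φ x = 0 := φ.zero_of_le_dist (by simp [φ, hx])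
    have h2 : G x = x := by simp [G, h1]
    have h3 : R + 1 ≠ 0 := by linarith
    simp only [h2, hx, div_self h3, one_smul]

/-- Surjectivity of coercive continuous maps on a finite-dimensional real
inner product space (Deimling, Theorem 3.3). -/
theorem coercive_continuous_surjective {X : Type*} [NormedAddCommGroup X]
    [InnerProductSpace ℝ X] [FiniteDimensional ℝ X]
    (T : X → X) (hcont : Continuous T)
    (hcoer : ∀ M : ℝ, ∃ R : ℝ, ∀ w : X, R ≤ ‖w‖ → M ≤ ⟪T w, w⟫ / ‖w‖) :
    Function.Surjective T := by
  intro L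
  obtain ⟨R, hR⟩ := hcoer (‖L‖ + 1)
  obtain ⟨x, hx⟩ := aux_zero (fun x => T x - L) (by fun_prop) (max R 1) (by positivity) (by
    intro x hx
    have h1 := hR x ((le_max_left _ _).trans hx)
    have h2 : 0 < ‖x‖ := zero_lt_one.trans_le ((le_max_right _ _).trans hx)
    rw [le_div_iff₀ h2] at h1
    have h3 := real_inner_le_norm L x
    rw [inner_sub_left]
    nlinarith)
  exact ⟨x, sub_eq_zero.1 hx⟩
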